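/- Let n ≥ 1 and let π be any n-cycle in S_n. Then C(n+1, 2) · G_π(z) = Σ_{σ ∈ S_{n+1}, c(σ) ≡ n (mod 2)} z^{c(σ)}, where C(n+1,2) = (n+1)n/2 and the sum on the right runs over all permutations σ of {1,…,n+1} whose cycle count c(σ) has the same parity as n. -/

import Mathlib

open Finset Polynomial

/-- Number of cycles of a permutation, counting fixed points as cycles of length 1
(equivalently, the number of orbits). -/
noncomputable def cycleCount {α : Type*} [Fintype α] [DecidableEq α] (σ : Equiv.Perm α) : ℕ :=
  σ.cycleType.card + (Finset.univ.filter fun x => σ x = x).card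

/-- The IO-polynomial `F_π(z) = Σ_{ζ ∈ Q_n} z^⌊(c(ζπ)-1)/2⌋`, where `Q_n` is the set of
`n`-cycles of `S_n` (i.e. permutations with a single cycle), and `ζπ` applies `ζ` first
and then `π`. -/
noncomputable def IOPoly {n : ℕ} (π : Equiv.Perm (Fin n)) : Polynomial ℝ :=
  ∑ ζ ∈ Finset.univ.filter (fun ζ : Equiv.Perm (Fin n) => cycleCount ζ = 1),
    Polynomial.X ^ ((cycleCount (π * ζ) - 1) / 2)
/-- The polynomial `G_π(z) = Σ_{ζ ∈ Q_n} z^{c(ζπ)}`. -/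
noncomputable def GPoly {n : ℕ} (π : Equiv.Perm (Fin n)) : Polynomial ℝ :=
  ∑ ζ ∈ Finset.univ.filter (fun ζ : Equiv.Perm (Fin n) => cycleCount ζ = 1),
    Polynomial.X ^ (cycleCount (π * ζ))

open Equiv Equiv.Perm

theorem cycleCount_eq_card_quotient {α : Type*} [Fintype α] [DecidableEq α] (σ : Perm α) :
    cycleCount σ = Nat.card (Quotient (SameCycle.setoid σ)) := by
  classical
  let F : α → Perm α ⊕ α := fun x => if σ x = x then Sum.inr x else Sum.inl (σ.cycleOf x)
  have hF : SameCycle.setoid σ = Setoid.ker F := by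
    ext x y
    change SameCycle σ x y ↔ F x = F y
    by_cases hx : σ x = x <;> by_cases hy : σ y = y
    · simp only [F, hx, hy, if_true, Sum.inr.injEq]
      exact ⟨fun h => h.eq_of_left hx, fun h => h ▸ SameCycle.refl _ _⟩
    · simp only [F, hx, hy, if_true, if_false, reduceCtorEq, iff_false]
      exact fun h => hy (h.apply_eq_self_iff.1 hx)
    · simp only [F, hx, hy, if_true, if_false, reduceCtorEq, iff_false]
      exact fun h => hx (h.apply_eq_self_iff.2 hy)
    · simp only [F, hx, hy, if_false, Sum.inl.injEq]
      exact sameCycle_iff_cycleOf_eq_of_mem_support (mem_support.2 hx) (mem_support.2 hy)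
  rw [hF, Nat.card_congr (Setoid.quotientKerEquivRange F)]
  have himg : Set.range F =
      ↑(σ.cycleFactorsFinset.disjSum (Finset.univ.filter fun x => σ x = x)) := by
    ext z
    rcases z with c | x
    · simp only [Set.mem_range, Finset.mem_coe, Finset.inl_mem_disjSum]
      constructor
      · rintro ⟨x, hx⟩
        by_cases h : σ x = x
        · simp [F, h] at hx
        · simp only [F, h, if_false, Sum.inl.injEq] at hx
          rw [← hx, cycleOf_mem_cycleFactorsFinset_iff]
          exact mem_support.2 h
      · intro hc
        obtain ⟨x, hx⟩ := (mem_cycleFactorsFinset_iff.1 hc).1.nonempty_support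
        have hcx := cycle_is_cycleOf hx hc
        refine ⟨x, ?_⟩
        have : σ x ≠ x := mem_support.1 (mem_cycleFactorsFinset_support_le hc hx)
        simp [F, this, hcx]
    · simp only [Set.mem_range, Finset.mem_coe, Finset.inr_mem_disjSum, Finset.mem_filter,
        Finset.mem_univ, true_and]
      constructor
      · rintro ⟨y, hy⟩
        by_cases h : σ y = y
        · simp only [F, h, if_true, Sum.inr.injEq] at hy
          exact hy ▸ h
        · simp [F, h] at hy
      · intro h
        exact ⟨x, by simp [F, h]⟩
  rw [himg, Nat.card_coe_set_eq, Set.ncard_coe_finset, Finset.card_disjSum, cycleCount,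
    cycleType_def]
  simp

theorem cycleCount_permCongr {α β : Type*} [Fintype α] [DecidableEq α] [Fintype β]
    [DecidableEq β] (f : α ≃ β) (σ : Perm α) : cycleCount (f.permCongr σ) = cycleCount σ := by
  rw [cycleCount_eq_card_quotient, cycleCount_eq_card_quotient]
  refine (Nat.card_congr (Quotient.congr f fun a b => ?_)).symm
  change SameCycle σ a b ↔ SameCycle (f.permCongr σ) (f a) (f b)
  have key : ∀ (n : ℤ) (a : α), (f.permCongr σ ^ n) (f a) = f ((σ ^ n) a) := by
    intro n a
    have h := map_zpow (f.permCongrHom) σ n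
    have h2 := congrArg (fun g : Perm β => g (f a)) h
    simpa [Equiv.permCongrHom] using h2.symm
  simp [SameCycle, key]

theorem cycleCount_conj {α : Type*} [Fintype α] [DecidableEq α] (σ τ : Perm α) :
    cycleCount (τ * σ * τ⁻¹) = cycleCount σ :=
  cycleCount_permCongr τ σ

theorem cycleCount_sumCongr {α β : Type*} [Fintype α] [DecidableEq α] [Fintype β]
    [DecidableEq β] (σ : Perm α) (τ : Perm β) :
    cycleCount (Perm.sumCongr σ τ) = cycleCount σ + cycleCount τ := by
  classical
  have key : ∀ n : ℤ, (Perm.sumCongr σ τ) ^ n = Perm.sumCongr (σ ^ n) (τ ^ n) := by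
    intro n
    exact (map_zpow (Perm.sumCongrHom α β) (σ, τ) n).symm
  have hl : ∀ a b, SameCycle (Perm.sumCongr σ τ) (Sum.inl a) (Sum.inl b) ↔ SameCycle σ a b := by
    simp [SameCycle, key]
  have hr : ∀ a b, SameCycle (Perm.sumCongr σ τ) (Sum.inr a) (Sum.inr b) ↔ SameCycle τ a b := by
    simp [SameCycle, key]
  rw [cycleCount_eq_card_quotient, cycleCount_eq_card_quotient, cycleCount_eq_card_quotient,
    ← Nat.card_sum]
  let F : α ⊕ β → Quotient (SameCycle.setoid σ) ⊕ Quotient (SameCycle.setoid τ) :=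
    Sum.map (Quotient.mk _) (Quotient.mk _)
  have hF : SameCycle.setoid (Perm.sumCongr σ τ) = Setoid.ker F := by
    ext x y
    change SameCycle _ x y ↔ F x = F y
    rcases x with x | x <;> rcases y with y | y
    · rw [hl]
      simp only [F, Sum.map_inl, Sum.inl.injEq]
      exact (Quotient.eq (r := SameCycle.setoid σ)).symm
    · simp [SameCycle, key, F]
    · simp [SameCycle, key, F]
    · rw [hr]
      simp only [F, Sum.map_inr, Sum.inr.injEq]
      exact (Quotient.eq (r := SameCycle.setoid τ)).symm
  rw [hF]
  refine Nat.card_congr (Setoid.quotientKerEquivOfSurjective F ?_)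
  exact Sum.map_surjective.2 ⟨Quotient.mk_surjective, Quotient.mk_surjective⟩

theorem cycleCount_subtypeCongr {α : Type*} [Fintype α] [DecidableEq α] {p : α → Prop}
    [DecidablePred p] [Fintype {a // p a}] [Fintype {a // ¬p a}] (σ : Perm {a // p a}) (τ : Perm {a // ¬p a}) :
    cycleCount (Perm.subtypeCongr σ τ) = cycleCount σ + cycleCount τ := by
  rw [Perm.subtypeCongr, cycleCount_permCongr, cycleCount_sumCongr]

theorem cycleCount_optionCongr {α : Type*} [Fintype α] [DecidableEq α] (σ : Perm α) :
    cycleCount (optionCongr σ) = cycleCount σ + 1 := by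
  have h : optionCongr σ = (optionEquivSumPUnit α).symm.permCongr
      (Perm.sumCongr σ (1 : Perm PUnit.{1})) := by
    ext x : 1
    rcases x with _ | x <;> simp [Equiv.permCongr_apply]
  rw [h, cycleCount_permCongr, cycleCount_sumCongr]
  simp [cycleCount]

theorem sign_eq_neg_one_pow_cycleCount {α : Type*} [Fintype α] [DecidableEq α] (σ : Perm α) :
    sign σ = (-1) ^ (Fintype.card α + cycleCount σ) := by
  have h1 := σ.sum_cycleType
  have h2 := Finset.card_filter_add_card_filter_not (s := (Finset.univ : Finset α))
    (fun x => σ x = x)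
  have h3 : σ.support = Finset.univ.filter fun x => ¬ σ x = x := by ext; simp
  rw [sign_of_cycleType, cycleCount, ← Finset.card_univ, ← h2, ← h3, h1,
    show ∀ a b c : ℕ, a + b + (c + a) = b + c + 2 * a by intros; ring, pow_add _ _ (2 * _), pow_mul]
  simp

theorem sameCycle_swap_mul {α : Type*} [Finite α] [DecidableEq α] {γ : Perm α} {x y : α}
    (h : ¬ SameCycle γ x y) : SameCycle (swap x y * γ) x y := by
  have hex : ∃ m, 0 < m ∧ (γ ^ m) x = x := ⟨orderOf γ, orderOf_pos γ, by simp [pow_orderOf_eq_one]⟩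
  classical
  obtain ⟨hm0, hm⟩ := Nat.find_spec hex
  have hmin : ∀ i, 0 < i → i < Nat.find hex → (γ ^ i) x ≠ x :=
    fun i h0 hi h' => Nat.find_min hex hi ⟨h0, h'⟩
  generalize Nat.find hex = m at *
  have hy : ∀ i : ℕ, (γ ^ i) x ≠ y := fun i hi => h ⟨i, by simpa using hi⟩
  have hpow : ∀ i < m, ((swap x y * γ) ^ i) x = (γ ^ i) x := by
    intro i
    induction i with
    | zero => simp
    | succ i ih =>
      intro hi
      rw [pow_succ', Perm.mul_apply, ih (by omega), Perm.mul_apply, ← Perm.mul_apply γ,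
        ← pow_succ']
      exact swap_apply_of_ne_of_ne (hmin _ (by omega) hi) (hy _)
  obtain ⟨k, rfl⟩ : ∃ k, m = k + 1 := ⟨m - 1, by omega⟩
  refine ⟨(k + 1 : ℕ), ?_⟩
  rw [zpow_natCast, pow_succ', Perm.mul_apply, hpow k (by omega), Perm.mul_apply,
    ← Perm.mul_apply γ, ← pow_succ', hm, swap_apply_left]

theorem rel_of_sameCycle_of_rel_apply {α : Type*} {γ : Perm α} (r : Setoid α)
    (h : ∀ z, r z (γ z)) {a b : α} (hab : SameCycle γ a b) : r a b := by
  obtain ⟨n, rfl⟩ := hab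
  induction n using Int.induction_on with
  | zero => exact r.refl _
  | succ i ih =>
    rw [add_comm, zpow_add, zpow_one, Perm.mul_apply]
    exact r.trans ih (h _)
  | pred i ih =>
    refine r.trans ih (r.symm ?_)
    have := h ((γ ^ (-(i : ℤ) - 1)) a)
    rwa [← Perm.mul_apply, ← zpow_one_add, show 1 + (-(i : ℤ) - 1) = -i by ring] at this

theorem cycleCount_swap_mul_of_not_sameCycle {α : Type*} [Fintype α] [DecidableEq α]
    {γ : Perm α} {x y : α} (h : ¬ SameCycle γ x y) :
    cycleCount (swap x y * γ) + 1 = cycleCount γ := by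
  classical
  set δ := swap x y * γ with hδ
  have hxy : SameCycle δ x y := sameCycle_swap_mul h
  rw [cycleCount_eq_card_quotient, cycleCount_eq_card_quotient]
  let g : α → Quotient (SameCycle.setoid γ) := fun z =>
    if SameCycle γ z y then Quotient.mk _ x else Quotient.mk _ z
  have hmk : ∀ {a b : α}, (Quotient.mk (SameCycle.setoid γ) a = Quotient.mk _ b) ↔
      SameCycle γ a b := Quotient.eq (r := SameCycle.setoid γ)
  have hker : SameCycle.setoid δ = Setoid.ker g := by
    ext a b
    change SameCycle δ a b ↔ g a = g b
    constructor
    · refine rel_of_sameCycle_of_rel_apply (Setoid.ker g) fun z => ?_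
      change g z = g (δ z)
      rw [hδ, Perm.mul_apply]
      have hz : g z = g (γ z) := by
        simp only [g, sameCycle_apply_left]
        split_ifs
        · rfl
        · exact hmk.2 (sameCycle_apply_right.2 (SameCycle.refl _ _))
      rw [hz]
      have hgxy : g x = g y := by simp [g, SameCycle.refl]
      rcases eq_or_ne (γ z) x with h1 | h1
      · rw [h1, swap_apply_left, hgxy]
      · rcases eq_or_ne (γ z) y with h2 | h2
        · rw [h2, swap_apply_right, hgxy]
        · rw [swap_apply_of_ne_of_ne h1 h2]
    · have hle : ∀ {a b}, SameCycle γ a b → SameCycle δ a b := by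
        intro a b
        refine rel_of_sameCycle_of_rel_apply (SameCycle.setoid δ) fun z => ?_
        change SameCycle δ z (γ z)
        have h0 : SameCycle δ z (swap x y (γ z)) :=
          sameCycle_apply_right.2 (SameCycle.refl δ z)
        rcases eq_or_ne (γ z) x with h1 | h1
        · rw [h1, swap_apply_left] at h0
          exact h1 ▸ h0.trans hxy.symm
        · rcases eq_or_ne (γ z) y with h2 | h2
          · rw [h2, swap_apply_right] at h0
            exact h2 ▸ h0.trans hxy
          · rwa [swap_apply_of_ne_of_ne h1 h2] at h0
      have hg : ∀ a, ∃ a', g a = Quotient.mk _ a' ∧ SameCycle δ a a' := by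
        intro a
        by_cases ha : SameCycle γ a y
        · exact ⟨x, by simp [g, ha], (hle ha).trans hxy.symm⟩
        · exact ⟨a, by simp [g, ha], SameCycle.refl _ _⟩
      intro hab
      obtain ⟨a', ha, ha'⟩ := hg a
      obtain ⟨b', hb, hb'⟩ := hg b
      rw [ha, hb, hmk] at hab
      exact ha'.trans ((hle hab).trans hb'.symm)
  rw [hker, Nat.card_congr (Setoid.quotientKerEquivRange g)]
  have hr : Set.range g = {q | q ≠ Quotient.mk _ y} := by
    ext q
    simp only [Set.mem_range, Set.mem_ofPred_eq]
    constructor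
    · rintro ⟨a, rfl⟩
      simp only [g]
      split_ifs with ha
      · rwa [Ne, hmk]
      · rwa [Ne, hmk]
    · induction q using Quotient.inductionOn with
      | h a =>
        intro ha
        rw [Ne, hmk] at ha
        exact ⟨a, by simp [g, ha]⟩
  rw [hr, Nat.card_eq_fintype_card, Nat.card_eq_fintype_card]
  simp only [Set.coe_ofPred]
  have := Fintype.card_subtype_compl (fun q => q = Quotient.mk (SameCycle.setoid γ) y)
  have h1 : 0 < Fintype.card (Quotient (SameCycle.setoid γ)) :=
    Fintype.card_pos_iff.2 ⟨Quotient.mk _ y⟩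
  simp only [Fintype.card_subtype_eq] at this
  simp only [ne_eq]
  omega

theorem sum_pow_cycleCount {R : Type*} [CommRing R] (z : R) (α : Type*) [Fintype α]
    [DecidableEq α] :
    ∑ σ : Perm α, z ^ cycleCount σ = ∏ i ∈ Finset.range (Fintype.card α), (z + i) := by
  classical
  suffices h : ∀ [DecidableEq α],
      ∑ σ : Perm α, z ^ cycleCount σ = ∏ i ∈ Finset.range (Fintype.card α), (z + i) from h
  refine Fintype.induction_empty_option (P := fun α _ => ∀ [DecidableEq α],
      ∑ σ : Perm α, z ^ cycleCount σ = ∏ i ∈ Finset.range (Fintype.card α), (z + i))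
    ?_ ?_ ?_ α
  · intro α β _ e ih _
    classical
    let _ : Fintype α := Fintype.ofEquiv β e.symm
    rw [← Fintype.card_congr e, ← ih]
    exact (Fintype.sum_equiv e.permCongr _ _ fun σ => by rw [cycleCount_permCongr]).symm
  · intro _
    simp [cycleCount]
  · intro α _ ih hdec
    classical
    obtain rfl : hdec = Option.instDecidableEq := Subsingleton.elim _ _
    have hsum : ∑ σ : Perm (Option α), z ^ cycleCount σ =
        ∑ q : Option α × Perm α, z ^ cycleCount (decomposeOption.symm q) :=
      (Fintype.sum_equiv decomposeOption.symm _ _ fun q => by congr!).symm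
    have hnone : ∀ e : Perm α, cycleCount (decomposeOption.symm (none, e)) = cycleCount e + 1 := by
      intro e
      rw [← cycleCount_optionCongr]
      congr 1
      ext x : 1
      simp [decomposeOption]
    have hsome : ∀ (a : α) (e : Perm α),
        cycleCount (decomposeOption.symm (some a, e)) = cycleCount e := by
      intro a e
      have h : ¬ SameCycle (optionCongr e) none (some a) := by
        intro h
        exact Option.some_ne_none a (h.eq_of_left rfl).symm
      have h2 := cycleCount_swap_mul_of_not_sameCycle h
      rw [cycleCount_optionCongr] at h2
      simpa [decomposeOption] using h2
    rw [hsum, Fintype.sum_prod_type, Fintype.sum_option]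
    simp only [hnone, hsome, pow_succ, ← Finset.sum_mul]
    rw [Fintype.card_option, Finset.prod_range_succ, ← ih]
    simp only [Finset.sum_const, Finset.card_univ, nsmul_eq_mul]
    ring

theorem sum_sign_mul_pow_cycleCount {R : Type*} [CommRing R] (z : R) (α : Type*) [Fintype α]
    [DecidableEq α] :
    ∑ σ : Perm α, ((sign σ : ℤ) : R) * z ^ cycleCount σ =
      ∏ i ∈ Finset.range (Fintype.card α), (z - i) := by
  have h := sum_pow_cycleCount (-z) α
  have h2 : ∏ i ∈ Finset.range (Fintype.card α), (z - i) =
      (-1) ^ Fintype.card α * ∏ i ∈ Finset.range (Fintype.card α), (-z + i) := by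
    rw [← Finset.card_range (Fintype.card α), ← Finset.prod_const, Finset.card_range,
      ← Finset.prod_mul_distrib]
    exact Finset.prod_congr rfl fun i _ => by ring
  rw [h2, ← h, Finset.mul_sum]
  refine Finset.sum_congr rfl fun σ _ => ?_
  rw [sign_eq_neg_one_pow_cycleCount, neg_pow z]
  push_cast
  ring

theorem cycleCount_eq_card_image_of_subtypeCongr {α : Type*} [Fintype α] [DecidableEq α]
    (S : Finset α) (σ : Perm {a // a ∈ S}) (τ : Perm {a // ¬a ∈ S})
    [DecidableEq (Quotient (SameCycle.setoid (Perm.subtypeCongr σ τ)))] :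
    cycleCount σ =
      (S.image (Quotient.mk (SameCycle.setoid (Perm.subtypeCongr σ τ)))).card := by
  rw [cycleCount_eq_card_quotient]
  let F : {a // a ∈ S} → Quotient (SameCycle.setoid (Perm.subtypeCongr σ τ)) :=
    fun a => Quotient.mk _ a.1
  have key : ∀ (n : ℤ) (a : {a // a ∈ S}),
      ((Perm.subtypeCongr σ τ) ^ n) a = ((σ ^ n) a : {a // a ∈ S}) := by
    intro n a
    have h := (map_zpow (Perm.subtypeCongrHom (· ∈ S)) (σ, τ) n).symm
    have h2 := congrArg (fun g : Perm α => g a) h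
    simpa [Perm.subtypeCongrHom] using h2
  have hF : SameCycle.setoid σ = Setoid.ker F := by
    ext x y
    change SameCycle σ x y ↔ F x = F y
    refine Iff.trans ?_ (Quotient.eq (r := SameCycle.setoid (Perm.subtypeCongr σ τ))).symm
    change SameCycle σ x y ↔ SameCycle (Perm.subtypeCongr σ τ) x y
    exact exists_congr fun n => by rw [key, Subtype.ext_iff]
  rw [hF, Nat.card_congr (Setoid.quotientKerEquivRange F), ← Set.ncard_coe_finset,
    Nat.card_coe_set_eq]
  congr 1
  ext q
  simp [F]

theorem sum_invariant_finsets {α : Type*} [Fintype α] [DecidableEq α] (ζ : Perm α) (p : α)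
    [DecidableEq (Quotient (SameCycle.setoid ζ))] :
    ∑ S ∈ Finset.univ.filter (fun S : Finset α => p ∉ S ∧ ∀ x, ζ x ∈ S ↔ x ∈ S),
      (-1 : ℤ) ^ (S.image (Quotient.mk (SameCycle.setoid ζ))).card =
      if cycleCount ζ = 1 then 1 else 0 := by
  classical
  have hinv : ∀ S : Finset α, (∀ x, ζ x ∈ S ↔ x ∈ S) → ∀ x y, SameCycle ζ x y →
      (x ∈ S ↔ y ∈ S) := by
    intro S hS x y hxy
    have := rel_of_sameCycle_of_rel_apply (Setoid.ker (· ∈ S)) (γ := ζ)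
      (fun z => (propext (hS z)).symm) hxy
    exact iff_of_eq this
  have hmk : ∀ {a b : α}, (Quotient.mk (SameCycle.setoid ζ) a = Quotient.mk _ b) ↔
      SameCycle ζ a b := Quotient.eq (r := SameCycle.setoid ζ)
  have hcard : cycleCount ζ = 1 ↔
      (Finset.univ.erase (Quotient.mk (SameCycle.setoid ζ) p)) = ∅ := by
    rw [cycleCount_eq_card_quotient, Nat.card_eq_fintype_card, ← Finset.card_eq_zero,
      Finset.card_erase_of_mem (Finset.mem_univ _), Finset.card_univ]
    have : 0 < Fintype.card (Quotient (SameCycle.setoid ζ)) :=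
      Fintype.card_pos_iff.2 ⟨Quotient.mk _ p⟩
    omega
  simp only [hcard]
  rw [← Finset.sum_powerset_neg_one_pow_card]
  refine Finset.sum_bij' (fun S _ => S.image (Quotient.mk (SameCycle.setoid ζ)))
    (fun T _ => Finset.univ.filter fun x => Quotient.mk (SameCycle.setoid ζ) x ∈ T)
    ?_ ?_ ?_ ?_ ?_
  · intro S hS
    obtain ⟨hp, hS⟩ := (Finset.mem_filter.1 hS).2
    rw [Finset.mem_powerset]
    intro q hq
    obtain ⟨x, hx, rfl⟩ := Finset.mem_image.1 hq
    refine Finset.mem_erase.2 ⟨fun h => hp ?_, Finset.mem_univ _⟩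
    exact (hinv S hS _ _ (hmk.1 h)).1 hx
  · intro T hT
    rw [Finset.mem_powerset] at hT
    refine Finset.mem_filter.2 ⟨Finset.mem_univ _, ?_, ?_⟩
    · intro h
      exact (Finset.mem_erase.1 (hT (Finset.mem_filter.1 h).2)).1 rfl
    · intro x
      have : Quotient.mk (SameCycle.setoid ζ) (ζ x) = Quotient.mk _ x :=
        hmk.2 (sameCycle_apply_left.2 (SameCycle.refl _ _))
      simp [this]
  · intro S hS
    obtain ⟨hp, hS⟩ := (Finset.mem_filter.1 hS).2
    ext x
    simp only [Finset.mem_filter, Finset.mem_univ, true_and, Finset.mem_image]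
    constructor
    · rintro ⟨y, hy, hxy⟩
      exact (hinv S hS _ _ (hmk.1 hxy)).1 hy
    · exact fun hx => ⟨x, hx, rfl⟩
  · intro T hT
    ext q
    induction q using Quotient.inductionOn with
    | h a =>
      simp only [Finset.mem_image, Finset.mem_filter, Finset.mem_univ, true_and]
      constructor
      · rintro ⟨x, hx, h⟩
        exact h ▸ hx
      · exact fun h => ⟨a, h, rfl⟩
  · intro S _
    rfl

theorem sum_perm_prod_perm_compl {R : Type*} [CommRing R] {α : Type*} [Fintype α]
    [DecidableEq α] (f : Perm α → R) (S : Finset α)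
    [∀ ζ : Perm α, DecidableEq (Quotient (SameCycle.setoid ζ))] :
    ∑ e : Perm {a // a ∈ S} × Perm {a // ¬a ∈ S},
        (-1) ^ cycleCount e.1 * f (Perm.subtypeCongr e.1 e.2) =
      ∑ ζ : Perm α, if ∀ x, ζ x ∈ S ↔ x ∈ S then
        (-1) ^ (S.image (Quotient.mk (SameCycle.setoid ζ))).card * f ζ else 0 := by
  rw [← Finset.sum_filter]
  refine Finset.sum_nbij (fun e => Perm.subtypeCongr e.1 e.2) ?_ ?_ ?_ ?_
  · intro e _
    refine Finset.mem_filter.2 ⟨Finset.mem_univ _, fun x => ?_⟩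
    by_cases hx : x ∈ S
    · simp [Perm.subtypeCongr.left_apply, hx]
    · simp only [Perm.subtypeCongr.right_apply _ _ hx, hx, iff_false]
      exact (e.2 ⟨x, hx⟩).2
  · exact (Perm.subtypeCongrHom_injective (· ∈ S)).injOn
  · intro ζ hζ
    have hζ := (Finset.mem_filter.1 hζ).2
    refine ⟨(ζ.subtypePerm hζ, ζ.subtypePerm fun x => not_congr (hζ x)), by simp, ?_⟩
    ext x
    by_cases hx : x ∈ S
    · simp [Perm.subtypeCongr.left_apply, hx]
    · simp [Perm.subtypeCongr.right_apply, hx]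
  · intro e _
    rw [← cycleCount_eq_card_image_of_subtypeCongr]

theorem sum_cycleCount_eq_one {R : Type*} [CommRing R] {α : Type*} [Fintype α] [DecidableEq α]
    (p : α) (f : Perm α → R) :
    ∑ ζ ∈ Finset.univ.filter (fun ζ : Perm α => cycleCount ζ = 1), f ζ =
      ∑ S ∈ Finset.univ.filter (fun S : Finset α => p ∉ S),
        ∑ e : Perm {a // a ∈ S} × Perm {a // ¬a ∈ S},
          (-1) ^ cycleCount e.1 * f (Perm.subtypeCongr e.1 e.2) := by
  classical
  rw [Finset.sum_congr rfl fun S _ => sum_perm_prod_perm_compl f S, Finset.sum_comm, Finset.sum_filter]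
  refine Finset.sum_congr rfl fun ζ _ => ?_
  rw [← Finset.sum_filter, Finset.filter_filter, ← Finset.sum_mul]
  have h := congrArg (Int.cast : ℤ → R) (sum_invariant_finsets ζ p)
  push_cast at h
  rw [h]
  split_ifs <;> simp

theorem neg_one_pow_cycleCount {R : Type*} [CommRing R] {α : Type*} [Fintype α] [DecidableEq α]
    (σ : Perm α) :
    (-1 : R) ^ cycleCount σ = (-1) ^ Fintype.card α * ((sign σ : ℤ) : R) := by
  rw [sign_eq_neg_one_pow_cycleCount]
  push_cast
  rw [pow_add, ← mul_assoc, ← mul_pow]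
  simp

theorem neg_one_pow_cycleCount_mul {R : Type*} [CommRing R] {α : Type*} [Fintype α]
    [DecidableEq α] (σ τ : Perm α) :
    (-1 : R) ^ cycleCount (σ * τ) = (-1) ^ cycleCount σ * ((sign τ : ℤ) : R) := by
  rw [neg_one_pow_cycleCount, neg_one_pow_cycleCount, Perm.sign_mul]
  push_cast
  ring

theorem subtypeCongr_mul {α : Type*} {p : α → Prop} [DecidablePred p]
    (σ σ' : Perm {a // p a}) (τ τ' : Perm {a // ¬p a}) :
    Perm.subtypeCongr (σ * σ') (τ * τ') =
      Perm.subtypeCongr σ τ * Perm.subtypeCongr σ' τ' :=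
  map_mul (Perm.subtypeCongrHom p) (σ, τ) (σ', τ')

theorem subtypeCongr_swap_one {α : Type*} [DecidableEq α] {p : α → Prop} [DecidablePred p]
    (i j : {a // p a}) :
    Perm.subtypeCongr (swap i j) (1 : Perm {a // ¬p a}) = swap (i : α) j := by
  ext x
  by_cases hx : p x
  · simp only [Perm.subtypeCongr.left_apply _ _ hx, swap_apply_def, Subtype.ext_iff]
    split_ifs <;> rfl
  · rw [Perm.subtypeCongr.right_apply _ _ hx, swap_apply_of_ne_of_ne]
    · rfl
    · rintro rfl
      exact hx i.2
    · rintro rfl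
      exact hx j.2

theorem subtypeCongr_one_swap {α : Type*} [DecidableEq α] {p : α → Prop} [DecidablePred p]
    (i j : {a // ¬p a}) :
    Perm.subtypeCongr (1 : Perm {a // p a}) (swap i j) = swap (i : α) j := by
  ext x
  by_cases hx : p x
  · rw [Perm.subtypeCongr.left_apply _ _ hx, swap_apply_of_ne_of_ne]
    · rfl
    · rintro rfl
      exact i.2 hx
    · rintro rfl
      exact j.2 hx
  · simp only [Perm.subtypeCongr.right_apply _ _ hx, swap_apply_def, Subtype.ext_iff]
    split_ifs <;> rfl

theorem sum_eq_zero_of_two_entries {R : Type*} [CommRing R] (z : R) {α : Type*} [Fintype α]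
    [DecidableEq α] (π : Perm α) (S : Finset α) {i j : α} (hij : i ≠ j) (hi : i ∈ S) (hj : j ∈ S)
    (hi' : π⁻¹ i ∉ S) (hj' : π⁻¹ j ∉ S) :
    ∑ e : Perm {a // a ∈ S} × Perm {a // ¬a ∈ S},
      (-1) ^ cycleCount e.1 * z ^ cycleCount (π * Perm.subtypeCongr e.1 e.2) = 0 := by
  let s : Perm {a // a ∈ S} := swap ⟨i, hi⟩ ⟨j, hj⟩
  let t : Perm {a // ¬a ∈ S} := swap ⟨π⁻¹ i, hi'⟩ ⟨π⁻¹ j, hj'⟩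
  have hs : sign s = -1 := sign_swap (by simpa [Subtype.ext_iff] using hij)
  refine Finset.sum_involution (fun e _ => (e.1 * s, t * e.2)) ?_ ?_ ?_ ?_
  · intro e _
    have h : π * Perm.subtypeCongr (e.1 * s) (t * e.2) =
        swap i j * (π * Perm.subtypeCongr e.1 e.2) * (swap i j)⁻¹ := by
      have h1 : Perm.subtypeCongr (e.1 * s) (t * e.2) =
          swap (π⁻¹ i) (π⁻¹ j) * Perm.subtypeCongr e.1 e.2 * swap i j := by
        rw [← subtypeCongr_swap_one (p := (· ∈ S)) ⟨i, hi⟩ ⟨j, hj⟩,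
          ← subtypeCongr_one_swap (p := (· ∈ S)) ⟨π⁻¹ i, hi'⟩ ⟨π⁻¹ j, hj'⟩,
          ← subtypeCongr_mul, ← subtypeCongr_mul]
        simp [s, t]
      rw [h1, ← mul_assoc, ← mul_assoc, ← swap_mul_eq_mul_swap, swap_inv, mul_assoc (swap i j)]
    dsimp only
    rw [h, cycleCount_conj, neg_one_pow_cycleCount_mul, hs]
    simp
  · intro e _ _ h
    have h1 : s = 1 := by simpa using congrArg Prod.fst h
    rw [h1] at hs
    simp at hs
  · intro e _
    exact Finset.mem_univ _
  · intro e _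
    simp [s, t, mul_assoc]

theorem cycleCount_pos {α : Type*} [Fintype α] [DecidableEq α] [Nonempty α] (σ : Perm α) :
    0 < cycleCount σ := by
  rw [cycleCount_eq_card_quotient]
  have : Nonempty (Quotient (SameCycle.setoid σ)) := ⟨Quotient.mk _ (Classical.arbitrary α)⟩
  exact Nat.card_pos

theorem mul_sum_of_one_entry {R : Type*} [CommRing R] (z : R) {α : Type*} [Fintype α]
    [DecidableEq α] {π : Perm α} (hπ : cycleCount π = 1) (S : Finset α) {x y : α} (hx : x ∉ S)
    (hy : y ∈ S) (hS : ∀ i ∈ S, swap x y (π i) ∈ S) :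
    z * ∑ e : Perm {a // a ∈ S} × Perm {a // ¬a ∈ S},
      (-1) ^ cycleCount e.1 * z ^ cycleCount (π * Perm.subtypeCongr e.1 e.2) =
    -((∏ i ∈ Finset.range S.card, (z - i)) *
      ∏ i ∈ Finset.range (Fintype.card α - S.card), (z + i)) := by
  classical
  have hiff : ∀ i, (swap x y * π) i ∈ S ↔ i ∈ S := by
    have hmap : S.map (swap x y * π).toEmbedding = S := by
      refine Finset.eq_of_subset_of_card_le ?_ (by simp)
      intro i hi
      obtain ⟨j, hj, rfl⟩ := Finset.mem_map.1 hi
      exact hS j hj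
    intro i
    conv_lhs => rw [← hmap]
    exact Finset.mem_map' _
  let r₁ : Perm {a // a ∈ S} := (swap x y * π).subtypePerm hiff
  let r₂ : Perm {a // ¬a ∈ S} := (swap x y * π).subtypePerm fun i => not_congr (hiff i)
  have hr : π = swap x y * Perm.subtypeCongr r₁ r₂ := by
    have : Perm.subtypeCongr r₁ r₂ = swap x y * π := by
      ext i
      by_cases hi : i ∈ S
      · simp [Perm.subtypeCongr.left_apply, hi, r₁]
      · simp [Perm.subtypeCongr.right_apply, hi, r₂]
    rw [this, swap_mul_self_mul]
  have hcc : ∀ e₁ e₂, cycleCount (π * Perm.subtypeCongr e₁ e₂) + 1 =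
      cycleCount (r₁ * e₁) + cycleCount (r₂ * e₂) := by
    intro e₁ e₂
    rw [← cycleCount_subtypeCongr (p := (· ∈ S)), subtypeCongr_mul]
    conv_lhs => rw [hr, mul_assoc]
    refine cycleCount_swap_mul_of_not_sameCycle fun h => hx ?_
    rw [← subtypeCongr_mul] at h
    have := rel_of_sameCycle_of_rel_apply (Setoid.ker (· ∈ S)) ?_ h
    · exact (iff_of_eq this).2 hy
    · intro i
      refine propext ?_
      by_cases hi : i ∈ S
      · simp only [hi, true_iff, Perm.subtypeCongr.left_apply (p := (· ∈ S)) _ _ hi]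
        exact Subtype.prop _
      · simp only [hi, false_iff, Perm.subtypeCongr.right_apply (p := (· ∈ S)) _ _ hi]
        exact ((r₂ * e₂) ⟨i, hi⟩).2
  have h1 : cycleCount r₁ = 1 := by
    have h := hcc 1 1
    have h11 : Perm.subtypeCongr (1 : Perm {a // a ∈ S}) (1 : Perm {a // ¬a ∈ S}) = 1 :=
      map_one (Perm.subtypeCongrHom (· ∈ S))
    rw [h11, mul_one, mul_one, mul_one, hπ] at h
    have : Nonempty {a // a ∈ S} := ⟨⟨y, hy⟩⟩
    have : Nonempty {a // ¬a ∈ S} := ⟨⟨x, hx⟩⟩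
    have := cycleCount_pos r₁
    have := cycleCount_pos r₂
    omega
  have hsg : ∀ e₁ : Perm {a // a ∈ S},
      (-1 : R) ^ cycleCount e₁ = -((sign (r₁ * e₁) : ℤ) : R) := by
    intro e₁
    have h2 := neg_one_pow_cycleCount (R := R) r₁
    rw [h1, pow_one] at h2
    have h3 : ((sign r₁ : ℤ) : R) * ((sign r₁ : ℤ) : R) = 1 := by
      rcases Int.units_eq_one_or (sign r₁) with h | h <;> simp [h]
    rw [neg_one_pow_cycleCount, Perm.sign_mul]
    push_cast
    linear_combination (-((sign e₁ : ℤ) : R) * ((sign r₁ : ℤ) : R)) * h2 -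
      (-1) ^ Fintype.card {a // a ∈ S} * ((sign e₁ : ℤ) : R) * h3
  have hc1 : Fintype.card {a // a ∈ S} = S.card := Fintype.card_coe S
  have hc2 : Fintype.card {a // ¬a ∈ S} = Fintype.card α - S.card := by
    rw [Fintype.card_subtype_compl, hc1]
  rw [← hc2, ← hc1, ← sum_sign_mul_pow_cycleCount, ← sum_pow_cycleCount, Finset.sum_mul_sum,
    Finset.mul_sum, Fintype.sum_prod_type, ← Finset.sum_neg_distrib]
  refine Fintype.sum_equiv (Equiv.mulLeft r₁) _ _ fun e₁ => ?_
  rw [← Finset.sum_neg_distrib]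
  refine Fintype.sum_equiv (Equiv.mulLeft r₂) _ _ fun e₂ => ?_
  simp only [Equiv.coe_mulLeft]
  rw [hsg, mul_left_comm, ← pow_succ', hcc, pow_add]
  ring

theorem sum_empty_entries {R : Type*} [CommRing R] (z : R) {α : Type*} [Fintype α]
    [DecidableEq α] (π : Perm α) :
    ∑ e : Perm {a // a ∈ (∅ : Finset α)} × Perm {a // ¬a ∈ (∅ : Finset α)},
      (-1) ^ cycleCount e.1 * z ^ cycleCount (π * Perm.subtypeCongr e.1 e.2) =
    ∏ i ∈ Finset.range (Fintype.card α), (z + i) := by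
  classical
  rw [sum_perm_prod_perm_compl (fun ζ => z ^ cycleCount (π * ζ)), ← sum_pow_cycleCount]
  refine Fintype.sum_equiv (Equiv.mulLeft π) _ _ fun ζ => ?_
  simp

theorem finRotate_symm_val {m : ℕ} {i : Fin (m + 1)} (hi : i ≠ 0) :
    (((finRotate (m + 1))⁻¹ i : Fin (m + 1)) : ℕ) + 1 = i := by
  have h : finRotate (m + 1) ((finRotate (m + 1))⁻¹ i) = i := by simp
  generalize (finRotate (m + 1))⁻¹ i = j at h
  subst h
  have hj : j ≠ Fin.last m := by
    rintro rfl
    exact hi finRotate_last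
  rw [coe_finRotate_of_ne_last hj]

theorem mul_sum_Icc {R : Type*} [CommRing R] (z : R) {m : ℕ}
    (hc : cycleCount (finRotate (m + 1)) = 1) {a b : Fin (m + 1)} (ha : 0 < a) (hab : a ≤ b) :
    z * ∑ e : Perm {i // i ∈ Finset.Icc a b} × Perm {i // ¬i ∈ Finset.Icc a b},
      (-1) ^ cycleCount e.1 * z ^ cycleCount (finRotate (m + 1) * Perm.subtypeCongr e.1 e.2) =
    -((∏ i ∈ Finset.range (b + 1 - a), (z - i)) *
      ∏ i ∈ Finset.range (m + 1 - (b + 1 - a)), (z + i)) := by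
  have hlast : finRotate (m + 1) b ∉ Finset.Icc a b := by
    rw [Finset.mem_Icc, not_and_or]
    rcases eq_or_ne b (Fin.last m) with rfl | hb
    · left
      rw [finRotate_last]
      exact not_le.2 ha
    · right
      rw [Fin.le_def, coe_finRotate_of_ne_last hb]
      omega
  have h := mul_sum_of_one_entry z hc (Finset.Icc a b) (x := finRotate (m + 1) b) (y := a) hlast
    (Finset.mem_Icc.2 ⟨le_rfl, hab⟩) ?_
  · rwa [Fin.card_Icc, Fintype.card_fin] at h
  · intro i hi
    obtain ⟨hai, hib⟩ := Finset.mem_Icc.1 hi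
    rcases eq_or_lt_of_le hib with rfl | hlt
    · rw [swap_apply_left]
      exact Finset.mem_Icc.2 ⟨le_rfl, hab⟩
    · have hne : i ≠ Fin.last m := (lt_of_lt_of_le hlt (Fin.le_last b)).ne
      have hv := coe_finRotate_of_ne_last hne
      rw [Fin.le_def] at hai
      rw [Fin.lt_def] at hlt
      rw [swap_apply_of_ne_of_ne]
      · rw [Finset.mem_Icc, Fin.le_def, Fin.le_def]
        omega
      · simpa using hlt.ne ∘ congrArg Fin.val
      · intro h
        have := congrArg Fin.val h
        omega

theorem eq_Icc_of_one_entry {m : ℕ} {S : Finset (Fin (m + 1))} (hne : S.Nonempty)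
    (h : ∀ i ∈ S, i ≠ S.min' hne → (finRotate (m + 1))⁻¹ i ∈ S) :
    S = Finset.Icc (S.min' hne) (S.max' hne) := by
  refine Finset.Subset.antisymm
    (fun i hi => Finset.mem_Icc.2 ⟨S.min'_le i hi, S.le_max' i hi⟩) fun i hi => ?_
  obtain ⟨h1, h2⟩ := Finset.mem_Icc.1 hi
  have key : ∀ d : ℕ, ∀ j : Fin (m + 1), S.min' hne ≤ j → (j : ℕ) + d = S.max' hne → j ∈ S := by
    intro d
    induction d with
    | zero =>
      intro j _ hj
      have : j = S.max' hne := Fin.ext (by simpa using hj)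
      exact this ▸ S.max'_mem hne
    | succ d ih =>
      intro j hj hd
      have hjm : j ≠ Fin.last m := by
        rintro rfl
        have := (S.max' hne).2
        rw [Fin.val_last] at hd
        omega
      have hv := coe_finRotate_of_ne_last hjm
      rw [Fin.le_def] at hj
      have hmem := ih (finRotate (m + 1) j) (by rw [Fin.le_def]; omega) (by omega)
      have := h _ hmem (fun hh => by have := congrArg Fin.val hh; omega)
      simpa using this
  rw [Fin.le_def] at h2
  exact key (S.max' hne - i) i h1 (by omega)

theorem sum_Fin_pairs {R : Type*} [AddCommMonoid R] (m : ℕ) (g : ℕ → R) :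
    ∑ q ∈ Finset.univ.filter (fun q : Fin (m + 1) × Fin (m + 1) => 0 < q.1 ∧ q.1 ≤ q.2),
      g (q.2 + 1 - q.1) = ∑ b ∈ Finset.range (m + 1), ∑ k ∈ Finset.range b, g (k + 1) := by
  rw [Finset.sum_sigma']
  refine Finset.sum_bij' (fun q _ => ⟨(q.2 : ℕ), (q.2 - q.1 : ℕ)⟩)
    (fun s _ => (Fin.ofNat (m + 1) (s.1 - s.2), Fin.ofNat (m + 1) s.1)) ?_ ?_ ?_ ?_ ?_
  · rintro ⟨a, b⟩ h
    simp only [Finset.mem_filter, Finset.mem_univ, true_and, Fin.lt_def, Fin.le_def,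
      Fin.val_zero] at h
    simp only [Finset.mem_sigma, Finset.mem_range]
    omega
  · rintro ⟨b, k⟩ h
    simp only [Finset.mem_sigma, Finset.mem_range] at h
    simp only [Finset.mem_filter, Finset.mem_univ, true_and, Fin.lt_def, Fin.le_def,
      Fin.val_zero, Fin.val_ofNat]
    rw [Nat.mod_eq_of_lt (by omega), Nat.mod_eq_of_lt (by omega)]
    omega
  · rintro ⟨a, b⟩ h
    simp only [Finset.mem_filter, Finset.mem_univ, true_and, Fin.lt_def, Fin.le_def,
      Fin.val_zero] at h
    ext
    · simp only [Fin.val_ofNat]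
      rw [Nat.mod_eq_of_lt (by omega)]
      omega
    · simp only [Fin.val_ofNat]
      rw [Nat.mod_eq_of_lt (by omega)]
  · rintro ⟨b, k⟩ h
    simp only [Finset.mem_sigma, Finset.mem_range] at h
    simp only [Fin.val_ofNat]
    rw [Nat.mod_eq_of_lt (by omega), Nat.mod_eq_of_lt (by omega)]
    congr 1
    omega
  · rintro ⟨a, b⟩ h
    simp only [Finset.mem_filter, Finset.mem_univ, true_and, Fin.lt_def, Fin.le_def,
      Fin.val_zero] at h
    dsimp only
    congr 1
    omega

theorem mul_sum_finRotate {R : Type*} [CommRing R] (z : R) (m : ℕ)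
    (hc : cycleCount (finRotate (m + 1)) = 1) :
    z * ∑ ζ ∈ Finset.univ.filter (fun ζ : Perm (Fin (m + 1)) => cycleCount ζ = 1),
        z ^ cycleCount (finRotate (m + 1) * ζ) =
      z * ∏ i ∈ Finset.range (m + 1), (z + i) -
      ∑ b ∈ Finset.range (m + 1), ∑ k ∈ Finset.range b,
        (∏ i ∈ Finset.range (k + 1), (z - i)) *
          ∏ i ∈ Finset.range (m + 1 - (k + 1)), (z + i) := by
  classical
  rw [sum_cycleCount_eq_one (0 : Fin (m + 1)) fun ζ => z ^ cycleCount (finRotate (m + 1) * ζ)]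
  set A : Finset (Fin (m + 1)) → R := fun S =>
    ∑ e : Perm {a // a ∈ S} × Perm {a // ¬a ∈ S},
      (-1) ^ cycleCount e.1 * z ^ cycleCount (finRotate (m + 1) * Perm.subtypeCongr e.1 e.2)
    with hA
  set P := Finset.univ.filter (fun q : Fin (m + 1) × Fin (m + 1) => 0 < q.1 ∧ q.1 ≤ q.2) with hP
  have hempty : A ∅ = ∏ i ∈ Finset.range (m + 1), (z + i) := by
    simpa using sum_empty_entries z (finRotate (m + 1))
  have hmemP : ∀ q, q ∈ P ↔ 0 < q.1 ∧ q.1 ≤ q.2 := by simp [hP]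
  have hnot : ∅ ∉ P.image fun q => Finset.Icc q.1 q.2 := by
    intro h
    obtain ⟨q, hq, h⟩ := Finset.mem_image.1 h
    exact Finset.Icc_eq_empty_iff.1 h ((hmemP q).1 hq).2
  have hsub : ∑ S ∈ Finset.univ.filter (fun S : Finset (Fin (m + 1)) => 0 ∉ S), A S =
      ∑ S ∈ insert ∅ (P.image fun q => Finset.Icc q.1 q.2), A S := by
    symm
    refine Finset.sum_subset ?_ ?_
    · intro S hS
      refine Finset.mem_filter.2 ⟨Finset.mem_univ _, ?_⟩
      rcases Finset.mem_insert.1 hS with rfl | hS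
      · simp
      · obtain ⟨q, hq, rfl⟩ := Finset.mem_image.1 hS
        intro h
        exact not_le.2 ((hmemP q).1 hq).1 (Finset.mem_Icc.1 h).1
    · intro S hS hS'
      have h0 : 0 ∉ S := (Finset.mem_filter.1 hS).2
      have hne : S.Nonempty := by
        rw [Finset.nonempty_iff_ne_empty]
        rintro rfl
        exact hS' (Finset.mem_insert_self _ _)
      have hmin : S.min' hne ≠ 0 := fun h => h0 (h ▸ S.min'_mem hne)
      by_cases hone : ∀ i ∈ S, i ≠ S.min' hne → (finRotate (m + 1))⁻¹ i ∈ S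
      · refine absurd (Finset.mem_insert_of_mem (Finset.mem_image.2
          ⟨(S.min' hne, S.max' hne), (hmemP _).2 ⟨Fin.pos_iff_ne_zero.2 hmin, ?_⟩,
            (eq_Icc_of_one_entry hne hone).symm⟩)) hS'
        exact S.min'_le _ (S.max'_mem hne)
      · push Not at hone
        obtain ⟨i, hi, hine, hi'⟩ := hone
        refine sum_eq_zero_of_two_entries z _ S hine hi (S.min'_mem hne) hi' fun h => ?_
        have h1 := S.min'_le _ h
        have h2 := finRotate_symm_val hmin
        rw [Fin.le_def] at h1
        omega
  have hinj : Set.InjOn (fun q : Fin (m + 1) × Fin (m + 1) => Finset.Icc q.1 q.2) P := by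
    intro q hq r hr h
    have hq := ((hmemP q).1 hq).2
    have h' : Set.Icc q.1 q.2 = Set.Icc r.1 r.2 := by
      simpa using congrArg (fun s : Finset (Fin (m + 1)) => (s : Set (Fin (m + 1)))) h
    obtain ⟨h1, h2⟩ := (Set.Icc_eq_Icc_iff hq).1 h'
    exact Prod.ext h1 h2
  rw [hsub, Finset.sum_insert hnot, hempty, Finset.sum_image hinj, mul_add, Finset.mul_sum,
    sub_eq_add_neg, ← sum_Fin_pairs m fun k => (∏ i ∈ Finset.range k, (z - i)) *
          ∏ i ∈ Finset.range (m + 1 - k), (z + i), ← Finset.sum_neg_distrib]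
  congr 1
  refine Finset.sum_congr rfl fun q hq => ?_
  exact mul_sum_Icc z hc ((hmemP q).1 hq).1 ((hmemP q).1 hq).2

theorem prod_telescope {R : Type*} [CommRing R] (z : R) (N k : ℕ) (hk : k ≤ N) :
    (N : R) * ((∏ i ∈ Finset.range k, (z - i)) * ∏ i ∈ Finset.range (N - k), (z + i)) =
      (∏ i ∈ Finset.range k, (z - i)) * ∏ i ∈ Finset.range (N + 1 - k), (z + i) -
      (∏ i ∈ Finset.range (k + 1), (z - i)) * ∏ i ∈ Finset.range (N + 1 - (k + 1)), (z + i) := by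
  obtain ⟨d, rfl⟩ := Nat.exists_eq_add_of_le hk
  rw [show k + d - k = d by omega, show k + d + 1 - k = d + 1 by omega,
    show k + d + 1 - (k + 1) = d by omega, Finset.prod_range_succ, Finset.prod_range_succ]
  push_cast
  ring

theorem sum_prod_telescope {R : Type*} [CommRing R] (z : R) (N b : ℕ) (hb : b ≤ N) :
    (N : R) * ∑ k ∈ Finset.range b, ((∏ i ∈ Finset.range (k + 1), (z - i)) *
        ∏ i ∈ Finset.range (N - (k + 1)), (z + i)) =
      z * (∏ i ∈ Finset.range N, (z + i)) -
      (∏ i ∈ Finset.range (b + 1), (z - i)) * ∏ i ∈ Finset.range (N + 1 - (b + 1)), (z + i) := by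
  rw [Finset.mul_sum]
  have h : ∀ k ∈ Finset.range b, (N : R) * ((∏ i ∈ Finset.range (k + 1), (z - i)) *
        ∏ i ∈ Finset.range (N - (k + 1)), (z + i)) = _ :=
    fun k hk => prod_telescope z N (k + 1) (by have := Finset.mem_range.1 hk; omega)
  rw [Finset.sum_congr rfl h, Finset.sum_range_sub' fun k =>
    (∏ i ∈ Finset.range (k + 1), (z - i)) * ∏ i ∈ Finset.range (N + 1 - (k + 1)), (z + i)]
  simp

theorem mul_mul_sum_sum_prod {R : Type*} [CommRing R] (z : R) (N : ℕ) :
    (N : R) * (N + 1) * ∑ b ∈ Finset.range N, ∑ k ∈ Finset.range b,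
        ((∏ i ∈ Finset.range (k + 1), (z - i)) *
          ∏ i ∈ Finset.range (N - (k + 1)), (z + i)) =
      N * (N + 1) * (z * ∏ i ∈ Finset.range N, (z + i)) -
      z * ((∏ i ∈ Finset.range (N + 1), (z + i)) - ∏ i ∈ Finset.range (N + 1), (z - i)) := by
  have h1 : (N : R) * ∑ b ∈ Finset.range N, ∑ k ∈ Finset.range b,
        ((∏ i ∈ Finset.range (k + 1), (z - i)) *
          ∏ i ∈ Finset.range (N - (k + 1)), (z + i)) = _ :=
    (Finset.mul_sum _ _ _).trans (Finset.sum_congr rfl fun b hb =>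
      sum_prod_telescope z N b (Finset.mem_range.1 hb).le)
  rw [Finset.sum_sub_distrib, Finset.sum_const, Finset.card_range, nsmul_eq_mul] at h1
  have h2 := sum_prod_telescope z (N + 1) N (Nat.le_succ N)
  rw [Nat.cast_add, Nat.cast_one] at h2
  rw [show N + 1 + 1 - (N + 1) = 1 by omega, Finset.prod_range_one, Nat.cast_zero, add_zero] at h2
  linear_combination ((N : R) + 1) * h1 - h2

theorem cycleType_of_cycleCount_eq_one {α : Type*} [Fintype α] [DecidableEq α]
    (hα : 2 ≤ Fintype.card α) {σ : Perm α} (h : cycleCount σ = 1) :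
    σ.cycleType = {Fintype.card α} := by
  have hfix : (Finset.univ.filter fun x => σ x = x).card = 0 := by
    by_contra hne
    have h0 : σ.cycleType.card = 0 := by
      unfold cycleCount at h
      omega
    have h1 : σ = 1 := card_cycleType_eq_zero.1 h0
    subst h1
    simp [cycleCount] at h
    omega
  have hcyc : σ.cycleType.card = 1 := by
    unfold cycleCount at h
    omega
  have hsupp : σ.support = Finset.univ := by
    ext x
    have hx := Finset.filter_eq_empty_iff.1 (Finset.card_eq_zero.1 hfix) (Finset.mem_univ x)
    simpa using hx
  rw [(card_cycleType_eq_one.1 hcyc).cycleType, hsupp, Finset.card_univ]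

theorem cycleCount_finRotate (m : ℕ) : cycleCount (finRotate (m + 1)) = 1 := by
  rcases m with _ | m
  · simp [cycleCount]
    rfl
  · have h : (finRotate (m + 2)).support = Finset.univ := support_finRotate
    have h2 : (Finset.univ.filter fun x => finRotate (m + 2) x = x) = ∅ := by
      refine Finset.filter_eq_empty_iff.2 fun x _ => ?_
      exact mem_support.1 (h ▸ Finset.mem_univ x)
    rw [cycleCount, h2, cycleType_finRotate]
    simp

theorem isConj_finRotate {m : ℕ} {π : Perm (Fin (m + 1))} (hπ : cycleCount π = 1) :
    IsConj (finRotate (m + 1)) π := by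
  rcases m with _ | m
  · have : Subsingleton (Fin (0 + 1)) := inferInstanceAs (Subsingleton (Fin 1))
    rw [Subsingleton.elim π (finRotate (0 + 1))]
  · rw [isConj_iff_cycleType_eq, cycleType_finRotate,
      cycleType_of_cycleCount_eq_one (by simp) hπ, Fintype.card_fin]

theorem GPoly_eq_of_isConj {n : ℕ} {π π' : Perm (Fin n)} (h : IsConj π π') :
    GPoly π = GPoly π' := by
  obtain ⟨c, rfl⟩ := isConj_iff.1 h
  refine Finset.sum_equiv (MulAut.conj c).toEquiv ?_ ?_
  · intro ζ
    simp [cycleCount_conj]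
  · intro ζ _
    have : c * π * c⁻¹ * (c * ζ * c⁻¹) = c * (π * ζ) * c⁻¹ := by group
    simp [this, cycleCount_conj]

theorem two_mul_sum_parity {R : Type*} [CommRing R] (z : R) (n : ℕ) :
    2 * ∑ σ ∈ Finset.univ.filter
        (fun σ : Perm (Fin (n + 1)) => cycleCount σ % 2 = n % 2), z ^ cycleCount σ =
      (∏ i ∈ Finset.range (n + 1), (z + i)) - ∏ i ∈ Finset.range (n + 1), (z - i) := by
  have h1 := sum_pow_cycleCount z (Fin (n + 1))
  have h2 := sum_sign_mul_pow_cycleCount z (Fin (n + 1))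
  rw [Fintype.card_fin] at h1 h2
  rw [← h1, ← h2, ← Finset.sum_sub_distrib, Finset.mul_sum, Finset.sum_filter]
  refine Finset.sum_congr rfl fun σ _ => ?_
  rw [sign_eq_neg_one_pow_cycleCount, Fintype.card_fin]
  split_ifs with h
  · rw [Odd.neg_one_pow (Nat.odd_iff.2 (by omega))]
    push_cast
    ring
  · rw [Even.neg_one_pow (Nat.even_iff.2 (by omega))]
    simp

/-- For an `n`-cycle `π`, `C(n+1,2)·G_π(z) = Σ z^{c(σ)}`, summed over all permutations
`σ` of `{1,…,n+1}` whose cycle count has the same parity as `n`. -/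
theorem stmt_9 (n : ℕ) (hn : 1 ≤ n) (π : Equiv.Perm (Fin n)) (hπ : cycleCount π = 1) :
    ((n + 1).choose 2 : ℕ) • GPoly π =
      ∑ σ ∈ Finset.univ.filter
          (fun σ : Equiv.Perm (Fin (n + 1)) => cycleCount σ % 2 = n % 2),
        (Polynomial.X : Polynomial ℝ) ^ (cycleCount σ) := by
  obtain ⟨m, rfl⟩ : ∃ m, n = m + 1 := ⟨n - 1, by omega⟩
  rw [← GPoly_eq_of_isConj (isConj_finRotate hπ), nsmul_eq_mul]
  have hG := mul_sum_finRotate (Polynomial.X : Polynomial ℝ) m (cycleCount_finRotate m)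
  have hS := mul_mul_sum_sum_prod (Polynomial.X : Polynomial ℝ) (m + 1)
  have hP := two_mul_sum_parity (Polynomial.X : Polynomial ℝ) (m + 1)
  have hch : (((m + 1 + 1).choose 2 : ℕ) : Polynomial ℝ) * 2 =
      ((m + 1 : ℕ) : Polynomial ℝ) * ((m + 1 : ℕ) + 1) := by
    have : (m + 1 + 1).choose 2 * 2 = (m + 1) * (m + 1 + 1) := by
      rw [Nat.choose_two_right, Nat.div_mul_cancel (Nat.even_mul_pred_self _).two_dvd]
      simp [mul_comm]
    exact_mod_cast this
  refine mul_left_cancel₀ (mul_ne_zero (two_ne_zero) (Polynomial.X_ne_zero (R := ℝ))) ?_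
  rw [GPoly]
  linear_combination Polynomial.X * (∑ ζ ∈ Finset.univ.filter
    (fun ζ : Perm (Fin (m + 1)) => cycleCount ζ = 1),
      (Polynomial.X : Polynomial ℝ) ^ cycleCount (finRotate (m + 1) * ζ)) * hch +
    ((m + 1 : ℕ) : Polynomial ℝ) * ((m + 1 : ℕ) + 1) * hG - hS - Polynomial.X * hP
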